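/- Let Γ = ⟨α_1, …, α_k⟩ ⊂ ℕ^d be an affine semigroup and 𝕂 a field. The ideals I_j = ⟨y^z − y^w : φ_Γ(z) = φ_Γ(w) and ||z| − |w|| ≤ j⟩ ⊂ 𝕂[y_1, …, y_k], for j ≥ 0, form an ascending chain I_0 ⊆ I_1 ⊆ I_2 ⊆ ⋯, and for every j ≥ 1 one has I_{j−1} ⊊ I_j if and only if j ∈ Δ(Γ). -/

import Mathlib

open Finset

/-- The factorization homomorphism `φ_Γ : ℕ^k → ℕ^d` determined by the
generators `α 1, …, α k`. -/
def phi {d k : ℕ} (α : Fin k → Fin d → ℕ) (z : Fin k → ℕ) : Fin d → ℕ :=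
  ∑ i, z i • α i

/-- The length `|z|` of a factorization. -/
def len {k : ℕ} (z : Fin k → ℕ) : ℕ := ∑ i, z i

/-- The length set `L_Γ(γ)`. -/
def lengthSet {d k : ℕ} (α : Fin k → Fin d → ℕ) (γ : Fin d → ℕ) : Set ℕ :=
  len '' {z | phi α z = γ}

/-- The set of successive differences (gaps) of a set of naturals. -/
def deltaOf (L : Set ℕ) : Set ℕ :=
  {δ | 0 < δ ∧ ∃ a, a ∈ L ∧ a + δ ∈ L ∧ ∀ c ∈ L, ¬(a < c ∧ c < a + δ)}

/-- The delta set `Δ(Γ)` of the affine semigroup generated by `α`. -/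
def deltaSet {d k : ℕ} (α : Fin k → Fin d → ℕ) : Set ℕ :=
  ⋃ γ ∈ Set.range (phi α), deltaOf (lengthSet α γ)

/-- The monomial `y^z = y_1^{z_1} ⋯ y_k^{z_k}` in `𝕂[y_1,…,y_k]`. -/
noncomputable def monoY (𝕂 : Type*) [CommSemiring 𝕂] {k : ℕ} (z : Fin k → ℕ) :
    MvPolynomial (Fin k) 𝕂 :=
  MvPolynomial.monomial (Finsupp.equivFunOnFinite.symm z) 1

/-- The ideal `I_j = ⟨y^z − y^w : φ_Γ(z) = φ_Γ(w), ||z|−|w|| ≤ j⟩`. -/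
noncomputable def idealI (𝕂 : Type*) [Field 𝕂] {d k : ℕ} (α : Fin k → Fin d → ℕ)
    (j : ℕ) : Ideal (MvPolynomial (Fin k) 𝕂) :=
  Ideal.span {f | ∃ z w : Fin k → ℕ, phi α z = phi α w ∧
    Nat.dist (len z) (len w) ≤ j ∧ f = monoY 𝕂 z - monoY 𝕂 w}

open Classical in
/-- A separating functional: sums the coefficients of the monomials `y^u` with
`φ(u) = γ` and `|u| ≤ a`. -/
noncomputable def sepF (𝕂 : Type*) [Field 𝕂] {d k : ℕ} (α : Fin k → Fin d → ℕ)
    (γ : Fin d → ℕ) (a : ℕ) : MvPolynomial (Fin k) 𝕂 →ₗ[𝕂] 𝕂 :=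
  (MvPolynomial.basisMonomials (Fin k) 𝕂).constr 𝕂
    (fun u => if phi α u = γ ∧ len u ≤ a then (1 : 𝕂) else 0)

open Classical in
theorem sepF_monomial (𝕂 : Type*) [Field 𝕂] {d k : ℕ} (α : Fin k → Fin d → ℕ)
    (γ : Fin d → ℕ) (a : ℕ) (u : Fin k →₀ ℕ) (c : 𝕂) :
    sepF 𝕂 α γ a (MvPolynomial.monomial u c) =
      c * if phi α u = γ ∧ len u ≤ a then (1 : 𝕂) else 0 := by
  have h1 : MvPolynomial.monomial u c = c • MvPolynomial.basisMonomials (Fin k) 𝕂 u := by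
    simp [MvPolynomial.smul_monomial]
  rw [h1, map_smul, sepF, Module.Basis.constr_basis, smul_eq_mul]

theorem phi_add {d k : ℕ} (α : Fin k → Fin d → ℕ) (z w : Fin k → ℕ) :
    phi α (z + w) = phi α z + phi α w := by
  simp [phi, add_smul, Finset.sum_add_distrib]

theorem len_add {k : ℕ} (z w : Fin k → ℕ) : len (z + w) = len z + len w := by
  simp [len, Finset.sum_add_distrib]

theorem sepF_ideal (𝕂 : Type*) [Field 𝕂] {d k : ℕ} (α : Fin k → Fin d → ℕ)
    (γ : Fin d → ℕ) (a j : ℕ) (hj : 1 ≤ j)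
    (hgap : ∀ c ∈ lengthSet α γ, ¬(a < c ∧ c < a + j))
    (x : MvPolynomial (Fin k) 𝕂) (hx : x ∈ idealI 𝕂 α (j - 1)) :
    ∀ q : MvPolynomial (Fin k) 𝕂, sepF 𝕂 α γ a (q * x) = 0 := by
  induction hx using Submodule.span_induction with
  | zero => simp
  | add x y _ _ hx hy => intro q; rw [mul_add, map_add, hx, hy, add_zero]
  | smul p x _ hx => intro q; rw [smul_eq_mul, ← mul_assoc]; exact hx _
  | mem x hx =>
    obtain ⟨z, w, hzw, hd, rfl⟩ := hx
    intro q
    induction q using MvPolynomial.induction_on' with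
    | add p q hp hq => rw [add_mul, map_add, hp, hq, add_zero]
    | monomial t c =>
      rw [mul_sub, map_sub, monoY, monoY, MvPolynomial.monomial_mul, MvPolynomial.monomial_mul,
        sepF_monomial, sepF_monomial]
      simp only [Finsupp.coe_add, Finsupp.equivFunOnFinite_symm_apply_apply, phi_add, len_add,
        Finsupp.coe_equivFunOnFinite_symm, hzw]
      by_cases hγ : phi α t + phi α w = γ
      · have h1 := hgap (len t + len z) ⟨t + z, by simp [phi_add, hzw, hγ], len_add _ _⟩
        have h2 := hgap (len t + len w) ⟨t + w, by simp [phi_add, hγ], len_add _ _⟩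
        have h3 : len (⇑t) + len z ≤ a ↔ len (⇑t) + len w ≤ a := by
          unfold Nat.dist at hd
          omega
        simp only [h3, sub_self]
      · simp [hγ]

theorem idealI_mono (𝕂 : Type*) [Field 𝕂] {d k : ℕ} (α : Fin k → Fin d → ℕ) {i j : ℕ}
    (h : i ≤ j) : idealI 𝕂 α i ≤ idealI 𝕂 α j := by
  refine Ideal.span_mono ?_
  rintro f ⟨z, w, h1, h2, h3⟩
  exact ⟨z, w, h1, h2.trans h, h3⟩

theorem mem_of_gap (𝕂 : Type*) [Field 𝕂] {d k : ℕ} (α : Fin k → Fin d → ℕ) (j : ℕ)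
    (hj : 1 ≤ j) (hn : j ∉ deltaSet α) (z w : Fin k → ℕ) (hzw : phi α z = phi α w)
    (hl : len w = len z + j) : monoY 𝕂 z - monoY 𝕂 w ∈ idealI 𝕂 α (j - 1) := by
  by_cases hex : ∃ c ∈ lengthSet α (phi α z), len z < c ∧ c < len z + j
  · obtain ⟨c, ⟨u, hu, rfl⟩, hc1, hc2⟩ := hex
    have hu' : phi α u = phi α z := hu
    rw [← sub_add_sub_cancel _ (monoY 𝕂 u) _]
    refine Ideal.add_mem _ (Ideal.subset_span ⟨z, u, hu'.symm, ?_, rfl⟩)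
      (Ideal.subset_span ⟨u, w, hu'.trans hzw, ?_, rfl⟩)
    · unfold Nat.dist; omega
    · unfold Nat.dist; omega
  · refine absurd ?_ hn
    simp only [deltaSet, Set.mem_iUnion]
    refine ⟨phi α z, ⟨z, rfl⟩, hj, len z, ⟨z, rfl, rfl⟩, ⟨w, hzw.symm, hl⟩, ?_⟩
    intro c hc hlt
    exact hex ⟨c, hc, hlt⟩

/-- The ideals `I_j` form an ascending chain, and for `j ≥ 1` one has
`I_{j−1} ⊊ I_j` if and only if `j ∈ Δ(Γ)`. -/
theorem stmt3 (𝕂 : Type*) [Field 𝕂] {d k : ℕ} (α : Fin k → Fin d → ℕ)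
    (hne : ∀ i, α i ≠ 0)
    (hmin : ∀ i, α i ∉ AddSubmonoid.closure (α '' {j | j ≠ i})) :
    (∀ j : ℕ, idealI 𝕂 α j ≤ idealI 𝕂 α (j + 1)) ∧
    (∀ j : ℕ, 1 ≤ j → (idealI 𝕂 α (j - 1) < idealI 𝕂 α j ↔ j ∈ deltaSet α)) := by
  refine ⟨fun j => idealI_mono 𝕂 α (Nat.le_succ j), fun j hj => ⟨fun hlt => ?_, fun hmem => ?_⟩⟩
  · by_contra hn
    refine hlt.not_ge (Ideal.span_le.2 ?_)
    rintro f ⟨z, w, hzw, hd, rfl⟩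
    by_cases h1 : Nat.dist (len z) (len w) ≤ j - 1
    · exact Ideal.subset_span ⟨z, w, hzw, h1, rfl⟩
    · have h2 : len w = len z + j ∨ len z = len w + j := by
        unfold Nat.dist at hd h1
        omega
      rcases h2 with h2 | h2
      · exact mem_of_gap 𝕂 α j hj hn z w hzw h2
      · rw [← neg_sub]
        exact neg_mem (mem_of_gap 𝕂 α j hj hn w z hzw.symm h2)
  · refine lt_of_le_of_ne (idealI_mono 𝕂 α (Nat.sub_le j 1)) fun heq => ?_
    simp only [deltaSet, Set.mem_iUnion] at hmem
    obtain ⟨γ, -, -, a, ⟨z, hz, hza⟩, ⟨w, hw, hwa⟩, hgap⟩ := hmem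
    have hz' : phi α z = γ := hz
    have hw' : phi α w = γ := hw
    have hin : monoY 𝕂 z - monoY 𝕂 w ∈ idealI 𝕂 α (j - 1) := by
      rw [heq]
      refine Ideal.subset_span ⟨z, w, hz'.trans hw'.symm, ?_, rfl⟩
      unfold Nat.dist
      omega
    have h0 := sepF_ideal 𝕂 α γ a j hj hgap _ hin 1
    rw [one_mul, map_sub, monoY, monoY, sepF_monomial, sepF_monomial] at h0
    have h4 : ¬ (a + j ≤ a) := by omega
    simp [hz', hw', hza, hwa, h4] at h0
    try omega
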